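/- Let 0 < b < x < x₀ be real numbers. Then ∫_x^{x₀} r² · ( r(r−x)(r−b)(r+x+b) )^{−1/2} dr = (β/(2n²(n−1))) · [ n(p−n)·E(ψ₀,p) + (n² − 2np + (2n−1)p²)·F(ψ₀,p) + (n−p)(n² + 2np − 2n − p)·Π(n;ψ₀,p) − n²(p−n)·( sin ψ₀ cos ψ₀ √(1 − p sin²ψ₀) / (1 − n sin²ψ₀) ) ], where β = 2√(x³/(x+2b)), p = b(2x+b)/(x(x+2b)), n = (2x+b)/(x+2b), ψ₀ = arcsin √( ((x+2b)/(2x+b)) · ((x₀−x)/(x₀−b)) ), F(ψ₀,p) = ∫₀^{ψ₀} (1 − p sin²ψ)^{−1/2} dψ, E(ψ₀,p) = ∫₀^{ψ₀} (1 − p sin²ψ)^{1/2} dψ, and Π(n;ψ₀,p) = ∫₀^{ψ₀} (1 − n sin²ψ)^{−1}(1 − p sin²ψ)^{−1/2} dψ. -/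

import Mathlib

open Set

/-- The incomplete elliptic integrals of the first two kinds are differentiable in the amplitude. -/
theorem hasDerivAt_integral_one_sub_mul_sin_sq_rpow {p : ℝ} (hp : p < 1) (a θ : ℝ) :
    HasDerivAt (fun t : ℝ => ∫ ψ in (0 : ℝ)..t, (1 - p * Real.sin ψ ^ 2) ^ a)
      ((1 - p * Real.sin θ ^ 2) ^ a) θ := by
  have hpos : ∀ ψ : ℝ, 0 < 1 - p * Real.sin ψ ^ 2 := fun ψ => by
    rcases le_or_gt p 0 with h | h <;> nlinarith [Real.sin_sq_le_one ψ, sq_nonneg (Real.sin ψ)]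
  have hc : Continuous fun ψ : ℝ => (1 - p * Real.sin ψ ^ 2) ^ a :=
    Continuous.rpow_const (by fun_prop) fun ψ => Or.inl (hpos ψ).ne'
  exact intervalIntegral.integral_hasDerivAt_right (hc.intervalIntegrable _ _)
    (hc.stronglyMeasurableAtFilter _ _) hc.continuousAt

theorem rpow_neg_one_div_two {y : ℝ} (hy : 0 ≤ y) : y ^ (-(1 : ℝ) / 2) = (√y)⁻¹ := by
  rw [neg_div, Real.rpow_neg hy, Real.sqrt_eq_rpow]

/-- Derivative of the elementary term produced when reducing the third-kind integral with a squared
denominator. -/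
theorem hasDerivAt_sin_mul_cos_mul_sqrt_div {p n θ : ℝ} (hp : 0 < 1 - p * Real.sin θ ^ 2)
    (hn : 1 - n * Real.sin θ ^ 2 ≠ 0) :
    HasDerivAt (fun t : ℝ => Real.sin t * Real.cos t * √(1 - p * Real.sin t ^ 2) /
        (1 - n * Real.sin t ^ 2))
      (((1 - 2 * Real.sin θ ^ 2) * (1 - p * Real.sin θ ^ 2) / (1 - n * Real.sin θ ^ 2)
        - p * Real.sin θ ^ 2 * (1 - Real.sin θ ^ 2) / (1 - n * Real.sin θ ^ 2)
        + 2 * n * Real.sin θ ^ 2 * (1 - Real.sin θ ^ 2) * (1 - p * Real.sin θ ^ 2) /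
          (1 - n * Real.sin θ ^ 2) ^ 2) / √(1 - p * Real.sin θ ^ 2)) θ := by
  have hs := Real.hasDerivAt_sin θ
  have hd := (((hs.pow 2).const_mul p).const_sub 1).sqrt hp.ne'
  have hm := ((hs.pow 2).const_mul n).const_sub 1
  refine (((hs.mul (Real.hasDerivAt_cos θ)).mul hd).div hm hn).congr_deriv ?_
  have hq : 0 < √(1 - p * Real.sin θ ^ 2) := Real.sqrt_pos.2 hp
  have hq2 := Real.sq_sqrt hp.le
  simp only [Pi.mul_apply, Pi.pow_apply]
  set d := √(1 - p * Real.sin θ ^ 2)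
  have hc2 : Real.cos θ ^ 2 = 1 - Real.sin θ ^ 2 := Real.cos_sq' θ
  rw [← hq2, ← hc2]
  generalize hS : Real.sin θ = S at *
  generalize Real.cos θ = c at *
  have h1 : 1 - 2 * S ^ 2 = c ^ 2 - S ^ 2 := by linarith
  rw [h1]
  field_simp
  norm_num
  ring

/-- The amplitude `arcsin √(k (r - x) / (r - b))` as a function of `r`. -/
theorem hasDerivAt_arcsin_sqrt_mobius {k b x r : ℝ} (hrb : r - b ≠ 0)
    (h0 : 0 < k * ((r - x) / (r - b))) (h1 : k * ((r - x) / (r - b)) < 1) :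
    HasDerivAt (fun t : ℝ => Real.arcsin √(k * ((t - x) / (t - b))))
      (k * (x - b) / (r - b) ^ 2 /
        (2 * √(k * ((r - x) / (r - b))) * √(1 - k * ((r - x) / (r - b))))) r := by
  have hs : HasDerivAt (fun t : ℝ => k * ((t - x) / (t - b))) (k * (x - b) / (r - b) ^ 2) r := by
    refine ((((hasDerivAt_id r).sub_const x).div ((hasDerivAt_id r).sub_const b) hrb).const_mul
      k).congr_deriv ?_
    simp only [id]
    ring
  have hlt : √(k * ((r - x) / (r - b))) < 1 := by
    rw [Real.sqrt_lt' one_pos]; simpa using h1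
  have hgt : √(k * ((r - x) / (r - b))) ≠ -1 :=
    (neg_one_lt_zero.trans_le (Real.sqrt_nonneg _)).ne'
  refine ((Real.hasDerivAt_arcsin hgt hlt.ne).comp r (hs.sqrt h0.ne')).congr_deriv ?_
  rw [Real.sq_sqrt h0.le]
  ring

/-- The algebraic reduction of the squared third-kind integrand; the constraint between `p` and `n`
makes the third-kind term disappear. -/
theorem elliptic_reduction {p n s : ℝ} (hn : n ≠ 0) (hn1 : n - 1 ≠ 0) (hs : 1 - n * s ≠ 0)
    (hpn : n ^ 2 + 2 * n * p - 2 * n - p = 0) :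
    (1 / (2 * n ^ 2 * (n - 1))) * (n * (p - n) * (1 - p * s)
      + (n ^ 2 - 2 * n * p + (2 * n - 1) * p ^ 2)
      - n ^ 2 * (p - n) * ((1 - 2 * s) * (1 - p * s) / (1 - n * s)
        - p * s * (1 - s) / (1 - n * s) + 2 * n * s * (1 - s) * (1 - p * s) / (1 - n * s) ^ 2))
      = ((1 - p * s) / (1 - n * s)) ^ 2 := by
  have h2n : 2 * n - 1 ≠ 0 := fun h => by
    obtain rfl : n = 1 / 2 := by linarith
    linarith
  obtain rfl : p = n * (2 - n) / (2 * n - 1) := by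
    rw [eq_div_iff h2n]; linear_combination hpn
  field_simp
  ring

/-- For `0 < b < x < x₀`,
`∫_x^{x₀} r² (r(r−x)(r−b)(r+x+b))^{−1/2} dr` equals
`(β/(2n²(n−1))) [ n(p−n)E(ψ₀,p) + (n²−2np+(2n−1)p²)F(ψ₀,p)
  + (n−p)(n²+2np−2n−p)Π(n;ψ₀,p) − n²(p−n) sinψ₀ cosψ₀ √(1−p sin²ψ₀)/(1−n sin²ψ₀) ]`
where `β = 2√(x³/(x+2b))`, `p = b(2x+b)/(x(x+2b))`, `n = (2x+b)/(x+2b)`,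
`ψ₀ = arcsin √(((x+2b)/(2x+b))((x₀−x)/(x₀−b)))`, and `F`, `E`, `Π` are the incomplete
elliptic integrals. -/
theorem stmt17 (b x x₀ : ℝ) (hb : 0 < b) (hbx : b < x) (hx : x < x₀) :
    let p : ℝ := b * (2 * x + b) / (x * (x + 2 * b))
    let n : ℝ := (2 * x + b) / (x + 2 * b)
    let β : ℝ := 2 * Real.sqrt (x ^ 3 / (x + 2 * b))
    let ψ₀ : ℝ :=
      Real.arcsin (Real.sqrt (((x + 2 * b) / (2 * x + b)) * ((x₀ - x) / (x₀ - b))))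
    let F : ℝ := ∫ ψ in (0 : ℝ)..ψ₀, (1 - p * Real.sin ψ ^ 2) ^ (-(1 : ℝ) / 2)
    let E : ℝ := ∫ ψ in (0 : ℝ)..ψ₀, (1 - p * Real.sin ψ ^ 2) ^ ((1 : ℝ) / 2)
    let Pi3 : ℝ := ∫ ψ in (0 : ℝ)..ψ₀,
      (1 - n * Real.sin ψ ^ 2)⁻¹ * (1 - p * Real.sin ψ ^ 2) ^ (-(1 : ℝ) / 2)
    (∫ r in x..x₀, r ^ 2 * (r * (r - x) * (r - b) * (r + x + b)) ^ (-(1 : ℝ) / 2)) =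
      (β / (2 * n ^ 2 * (n - 1))) *
        (n * (p - n) * E + (n ^ 2 - 2 * n * p + (2 * n - 1) * p ^ 2) * F +
          (n - p) * (n ^ 2 + 2 * n * p - 2 * n - p) * Pi3 -
          n ^ 2 * (p - n) *
            (Real.sin ψ₀ * Real.cos ψ₀ * Real.sqrt (1 - p * Real.sin ψ₀ ^ 2) /
              (1 - n * Real.sin ψ₀ ^ 2))) := by
  intro p n β ψ₀ F E Pi3
  have hx0 : 0 < x := hb.trans hbx
  have hxb : 0 < x + 2 * b := by positivity
  have h2xb : 0 < 2 * x + b := by positivity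
  have hn : 0 < n := by positivity
  have hn1 : 0 < n - 1 := by
    have : n - 1 = (x - b) / (x + 2 * b) := by simp only [n]; field_simp; ring
    rw [this]; exact div_pos (by linarith) hxb
  have hp1 : p < 1 := by
    rw [div_lt_one (by positivity)]; nlinarith
  have hpn : n ^ 2 + 2 * n * p - 2 * n - p = 0 := by
    simp only [p, n]; field_simp; ring
  have hpos : ∀ θ : ℝ, 0 < 1 - p * Real.sin θ ^ 2 := fun θ => by
    have : 0 ≤ p := by positivity
    nlinarith [Real.sin_sq_le_one θ]
  set k : ℝ := √(x ^ 3 / (x + 2 * b)) with hk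
  have hk0 : 0 < k := Real.sqrt_pos.2 (by positivity)
  have hk2 : k ^ 2 = x ^ 3 / (x + 2 * b) := Real.sq_sqrt (by positivity)
  let σ : ℝ → ℝ := fun r => (x + 2 * b) / (2 * x + b) * ((r - x) / (r - b))
  let ψ : ℝ → ℝ := fun r => Real.arcsin √(σ r)
  let H : ℝ → ℝ := fun θ => (β / (2 * n ^ 2 * (n - 1))) *
        (n * (p - n) * (∫ ψ in (0 : ℝ)..θ, (1 - p * Real.sin ψ ^ 2) ^ ((1 : ℝ) / 2)) +
          (n ^ 2 - 2 * n * p + (2 * n - 1) * p ^ 2) *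
            (∫ ψ in (0 : ℝ)..θ, (1 - p * Real.sin ψ ^ 2) ^ (-(1 : ℝ) / 2)) -
          n ^ 2 * (p - n) *
            (Real.sin θ * Real.cos θ * √(1 - p * Real.sin θ ^ 2) / (1 - n * Real.sin θ ^ 2)))
  have hH : ∀ θ, 1 - n * Real.sin θ ^ 2 ≠ 0 → HasDerivAt H
      (β * ((1 - p * Real.sin θ ^ 2) / (1 - n * Real.sin θ ^ 2)) ^ 2 /
        √(1 - p * Real.sin θ ^ 2)) θ := fun θ hθ => by
    refine (((((hasDerivAt_integral_one_sub_mul_sin_sq_rpow hp1 _ θ).const_mul _).add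
      ((hasDerivAt_integral_one_sub_mul_sin_sq_rpow hp1 _ θ).const_mul _)).sub
      ((hasDerivAt_sin_mul_cos_mul_sqrt_div (hpos θ) hθ).const_mul _)).const_mul _).congr_deriv ?_
    rw [← elliptic_reduction hn.ne' hn1.ne' hθ hpn, rpow_neg_one_div_two (hpos θ).le,
      ← Real.sqrt_eq_rpow]
    have hd := Real.sqrt_pos.2 (hpos θ)
    have hd2 := Real.mul_self_sqrt (hpos θ).le
    have hd3 : √(1 - p * Real.sin θ ^ 2) =
        (1 - p * Real.sin θ ^ 2) / √(1 - p * Real.sin θ ^ 2) := by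
      rw [eq_div_iff hd.ne', hd2]
    nth_rewrite 1 [hd3]
    ring
  have hσ0 : ∀ r, x ≤ r → 0 ≤ σ r := fun r hr => by
    have h1 : 0 ≤ r - x := by linarith
    have h2 : 0 < r - b := by linarith
    positivity
  have hσ1 : ∀ r, x ≤ r →
      1 - σ r = (x - b) * (r + x + b) / ((2 * x + b) * (r - b)) := fun r hr => by
    have h2 : r - b ≠ 0 := by linarith
    simp only [σ]; field_simp; ring
  have hσn : ∀ r, x ≤ r → 1 - n * σ r = (x - b) / (r - b) := fun r hr => by
    have h2 : r - b ≠ 0 := by linarith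
    simp only [σ, n]; field_simp; ring
  have hσp : ∀ r, x ≤ r → 1 - p * σ r = r * (x - b) / (x * (r - b)) := fun r hr => by
    have h2 : r - b ≠ 0 := by linarith
    simp only [σ, p]; field_simp; ring
  have hσlt : ∀ r, x ≤ r → σ r < 1 := fun r hr => by
    have h1 : 0 < x - b := by linarith
    have h2 : 0 < r - b := by linarith
    have h3 : 0 < r + x + b := by linarith
    have : 0 < 1 - σ r := by rw [hσ1 r hr]; positivity
    linarith
  have hsin : ∀ r, x ≤ r → Real.sin (ψ r) ^ 2 = σ r := fun r hr => by
    rw [Real.sin_arcsin (by linarith [Real.sqrt_nonneg (σ r)])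
      (Real.sqrt_le_one.2 (hσlt r hr).le), Real.sq_sqrt (hσ0 r hr)]
  have hne : ∀ r, x ≤ r → 1 - n * Real.sin (ψ r) ^ 2 ≠ 0 := fun r hr => by
    rw [hsin r hr, hσn r hr]
    exact (div_pos (by linarith) (by linarith)).ne'
  have hcont : ContinuousOn (fun r => H (ψ r)) (Icc x x₀) := by
    have hψ : ContinuousOn ψ (Icc x x₀) := by
      refine Real.continuous_arcsin.comp_continuousOn (Real.continuous_sqrt.comp_continuousOn ?_)
      refine ContinuousOn.mul continuousOn_const (ContinuousOn.div (by fun_prop) (by fun_prop) ?_)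
      intro r hr
      linarith [hr.1]
    intro r hr
    exact (hH _ (hne r hr.1)).continuousAt.comp_continuousWithinAt (hψ r hr)
  have hderiv : ∀ r ∈ Ioo x x₀, HasDerivAt (fun r => H (ψ r))
      (r ^ 2 * (r * (r - x) * (r - b) * (r + x + b)) ^ (-(1 : ℝ) / 2)) r := by
    intro r hr
    have h1 : 0 < x - b := by linarith
    have h2 : 0 < r - b := by linarith [hr.1]
    have h3 : 0 < r + x + b := by linarith [hr.1]
    have h4 : 0 < r - x := by linarith [hr.1]
    have h5 : 0 < r := by linarith
    have hs0 : 0 < σ r := by positivity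
    refine ((hH _ (hne r hr.1.le)).comp r
      (hasDerivAt_arcsin_sqrt_mobius h2.ne' hs0 (hσlt r hr.1.le))).congr_deriv ?_
    rw [hsin r hr.1.le, rpow_neg_one_div_two (by positivity)]
    change _ * (_ / (2 * √(σ r) * √(1 - σ r))) = _
    have hd0 : 0 < 1 - p * σ r := by rw [hσp r hr.1.le]; positivity
    have hc0 : 0 < 1 - σ r := by linarith [hσlt r hr.1.le]
    have hprod : √(σ r) * √(1 - σ r) * √(1 - p * σ r) =
        √(r * (r - x) * (r - b) * (r + x + b)) *
          (k / x ^ 2 * ((x + 2 * b) / (2 * x + b) * (x - b) / (r - b) ^ 2)) := by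
      rw [← Real.sqrt_mul hs0.le, ← Real.sqrt_mul (by positivity),
        Real.sqrt_eq_iff_mul_self_eq (by positivity) (by positivity), ← pow_two, mul_pow, mul_pow,
        Real.sq_sqrt (by positivity), div_pow, hk2, hσp r hr.1.le, hσ1 r hr.1.le]
      simp only [σ]
      field_simp
    have hq : (1 - p * σ r) / (1 - n * σ r) = r / x := by
      rw [hσp r hr.1.le, hσn r hr.1.le]; field_simp
    rw [hq]
    have hden : √(1 - p * σ r) * (2 * √(σ r) * √(1 - σ r)) =
        2 * (√(σ r) * √(1 - σ r) * √(1 - p * σ r)) := by ring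
    have hP : 0 < √(r * (r - x) * (r - b) * (r + x + b)) := Real.sqrt_pos.2 (by positivity)
    rw [div_mul_div_comm, hden, hprod]
    simp only [β, ← hk]
    field_simp
  have hint := intervalIntegral.integrableOn_deriv_of_nonneg hcont hderiv fun r hr => by
    have h2 : 0 < r - b := by linarith [hr.1]
    have h3 : 0 < r + x + b := by linarith [hr.1]
    have h4 : 0 < r - x := by linarith [hr.1]
    have h5 : 0 < r := by linarith
    positivity
  rw [intervalIntegral.integral_eq_sub_of_hasDerivAt_of_le hx.le hcont hderiv
    ((intervalIntegrable_iff_integrableOn_Ioc_of_le hx.le).2 hint)]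
  have hψx : ψ x = 0 := by simp [ψ, σ]
  have hthird : (n - p) * (n ^ 2 + 2 * n * p - 2 * n - p) * Pi3 = 0 := by rw [hpn]; ring
  rw [hthird, add_zero, hψx]
  simp [H, ψ₀, F, E, ψ, σ]
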